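/- arXiv:2407.01402 — 4 statements merged into one kernel-verified Lean document; each statement's English description precedes it below -/
import Mathlib

section
/- Let D ⊆ {0,1}^n and let f : D → {0,1} be a partial Boolean function. Then DT(f) ≤ 1 + Σ_{x ∈ f⁻¹(1)} Cert(f, x). -/
open Finset

attribute [local instance] Classical.propDecidable

/-- A binary decision tree querying coordinates of type `ι`. -/
inductive DTree (ι : Type) : Type where
  | leaf : Bool → DTree ι
  | node : ι → DTree ι → DTree ι → DTree ι

namespace DTree

/-- Evaluation of a decision tree on an input. -/
def eval {ι : Type} : DTree ι → (ι → Bool) → Bool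
  | .leaf b, _ => b
  | .node i t0 t1, x => if x i then t1.eval x else t0.eval x

/-- The size of a decision tree is its number of leaves. -/
def size {ι : Type} : DTree ι → ℕ
  | .leaf _ => 1
  | .node _ t0 t1 => t0.size + t1.size

/-- The restriction (set of literals) given by the root-to-leaf path followed by `x` in `T`. -/
noncomputable def pathRes {ι : Type} : DTree ι → (ι → Bool) → (ι → Option Bool)
  | .leaf _, _ => fun _ => none
  | .node i t0 t1, x =>
      Function.update (if x i then t1.pathRes x else t0.pathRes x) i (some (x i))

end DTree

/-- Apply a restriction to an input: coordinates fixed by `ρ` take their fixed value. -/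
def override {ι : Type} (ρ : ι → Option Bool) (x : ι → Bool) : ι → Bool :=
  fun i => (ρ i).getD (x i)

/-- The number of literals in a restriction. -/
noncomputable def resSize {ι : Type} [Fintype ι] (ρ : ι → Option Bool) : ℕ :=
  (Finset.univ.filter fun i => (ρ i).isSome).card

/-- A restriction `ρ` is consistent with the input `x`. -/
def Consistent {ι : Type} (ρ : ι → Option Bool) (x : ι → Bool) : Prop :=
  ∀ i b, ρ i = some b → x i = b

/-- `T` computes the partial function (represented by the total function `f`) on domain `D`. -/
def Computes {ι : Type} (T : DTree ι) (f : (ι → Bool) → Bool) (D : Finset (ι → Bool)) : Prop :=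
  ∀ x ∈ D, T.eval x = f x

/-- `DT(f)`: the minimal size of a decision tree computing the partial function `f : D → {0,1}`. -/
noncomputable def DTsize {ι : Type} (f : (ι → Bool) → Bool) (D : Finset (ι → Bool)) : ℕ :=
  sInf {s | ∃ T : DTree ι, Computes T f D ∧ T.size = s}

/-- The domain of the subfunction `f_ρ`: inputs whose `ρ`-override lies in `D`. -/
noncomputable def restrictD {ι : Type} [Fintype ι] (D : Finset (ι → Bool)) (ρ : ι → Option Bool) :
    Finset (ι → Bool) :=
  Finset.univ.filter fun x => override ρ x ∈ D

/-- The subfunction `f_ρ` of `f` obtained by fixing variables according to `ρ`. -/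
def restrictF {ι : Type} (f : (ι → Bool) → Bool) (ρ : ι → Option Bool) : (ι → Bool) → Bool :=
  fun x => f (override ρ x)

/-- The partial function `f : D → {0,1}` is constant on its domain. -/
def IsConstOn {ι : Type} (f : (ι → Bool) → Bool) (D : Finset (ι → Bool)) : Prop :=
  ∀ x ∈ D, ∀ y ∈ D, f x = f y

/-- `Cert(f, x)`: the minimal number of literals of a restriction `ρ` consistent with `x`
such that `f_ρ` is constant on its domain. -/
noncomputable def Cert {ι : Type} [Fintype ι] (f : (ι → Bool) → Bool) (D : Finset (ι → Bool))
    (x : ι → Bool) : ℕ :=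
  sInf {k | ∃ ρ : ι → Option Bool, Consistent ρ x ∧
    IsConstOn (restrictF f ρ) (restrictD D ρ) ∧ resSize ρ = k}

/-- `x` with bit `i` flipped. -/
noncomputable def flipBit {ι : Type} (x : ι → Bool) (i : ι) : ι → Bool :=
  Function.update x i (!(x i))

/-- `Sens(f, x)`: the set of sensitive neighbors of `x` that lie in the domain `D`. -/
noncomputable def sensSet {ι : Type} [Fintype ι] (f : (ι → Bool) → Bool) (D : Finset (ι → Bool))
    (x : ι → Bool) : Finset (ι → Bool) :=
  D.filter fun y => (∃ i, y = flipBit x i) ∧ f y ≠ f x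

/-- `Sens(f)`: the maximum sensitivity of the partial function `f : D → {0,1}`. -/
noncomputable def maxSens {ι : Type} [Fintype ι] (f : (ι → Bool) → Bool)
    (D : Finset (ι → Bool)) : ℕ :=
  D.sup fun x => (sensSet f D x).card

/-- `error_𝒟(T, f) = Pr_{x ∼ 𝒟}[T(x) ≠ f(x)]`, for a distribution given by its
probability mass function `𝒟`. -/
noncomputable def errD {ι : Type} [Fintype ι] (𝒟 : (ι → Bool) → ℝ) (T : DTree ι)
    (f : (ι → Bool) → Bool) : ℝ :=
  ∑ x : ι → Bool, 𝒟 x * (if T.eval x = f x then 0 else 1)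

/-- Trees for the two halves of `D` cut by coordinate `i` combine into a tree for `D`. -/
theorem exists_computes_of_split {ι : Type} (f : (ι → Bool) → Bool) (D : Finset (ι → Bool))
    (i : ι) (b : Bool) (S T : DTree ι)
    (hS : Computes S f (D.filter fun y => y i = b))
    (hT : Computes T f (D.filter fun y => ¬ y i = b)) :
    ∃ U : DTree ι, Computes U f D ∧ U.size = S.size + T.size := by
  cases b
  · refine ⟨.node i S T, fun y hy => ?_, rfl⟩
    have h1 := hS y
    have h2 := hT y
    by_cases h : y i <;> simp_all [DTree.eval]
  · refine ⟨.node i T S, fun y hy => ?_, Nat.add_comm _ _⟩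
    have h1 := hS y
    have h2 := hT y
    by_cases h : y i <;> simp_all [DTree.eval]

/-- Query the coordinates in `A` one by one, following `x`; inputs leaving the path of `x` are
handled by the trees supplied by `H`. -/
theorem exists_computes_of_certificate {ι : Type} (f : (ι → Bool) → Bool)
    (c : (ι → Bool) → ℕ) (E : Finset (ι → Bool)) (x : ι → Bool)
    (H : ∀ D ⊆ E, x ∉ D → ∃ T : DTree ι, Computes T f D ∧
      T.size ≤ 1 + ∑ y ∈ D.filter (fun y => f y = true), c y)
    (A : Finset ι) :
    ∀ D ⊆ E, (∀ y ∈ D, (∀ i ∈ A, y i = x i) → f y = true) →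
      ∃ T : DTree ι, Computes T f D ∧
        T.size ≤ 1 + A.card + ∑ y ∈ (D.erase x).filter (fun y => f y = true), c y := by
  induction A using Finset.induction_on with
  | empty =>
    intro D _ hA
    exact ⟨.leaf true, fun y hy => (hA y hy (by simp)).symm, by simp only [DTree.size]; omega⟩
  | insert i A hi ih =>
    intro D hD hA
    obtain ⟨S, hS, hSs⟩ := ih (D.filter fun y => y i = x i) ((filter_subset _ _).trans hD)
      (fun y hy h => by
        rw [mem_filter] at hy
        refine hA y hy.1 fun j hj => ?_
        rcases mem_insert.1 hj with rfl | hj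
        exacts [hy.2, h j hj])
    obtain ⟨T, hT, hTs⟩ := H (D.filter fun y => ¬ y i = x i) ((filter_subset _ _).trans hD)
      (by simp)
    obtain ⟨U, hU, hUs⟩ := exists_computes_of_split f D i (x i) S T hS hT
    refine ⟨U, hU, ?_⟩
    have key := sum_filter_add_sum_filter_not ((D.erase x).filter fun y => f y = true)
      (fun y => y i = x i) c
    have e1 : ((D.filter fun y => y i = x i).erase x).filter (fun y => f y = true) =
        ((D.erase x).filter fun y => f y = true).filter fun y => y i = x i := by
      ext y; simp only [mem_filter, mem_erase]; tauto
    have e2 : (D.filter fun y => ¬ y i = x i).filter (fun y => f y = true) =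
        ((D.erase x).filter fun y => f y = true).filter fun y => ¬ y i = x i := by
      ext y
      simp only [mem_filter, mem_erase]
      have : ¬ y i = x i → y ≠ x := fun h e => h (by rw [e])
      tauto
    rw [e1] at hSs
    rw [e2] at hTs
    rw [card_insert_of_notMem hi]
    omega

/-- If every one-input `x` of `D` has a certificate on at most `c x` coordinates, then `f` has a
decision tree on `D` of size at most `1 + ∑ c x`. -/
theorem exists_computes_size_le {ι : Type} (f : (ι → Bool) → Bool) (c : (ι → Bool) → ℕ)
    (D : Finset (ι → Bool))
    (hc : ∀ x ∈ D, f x = true → ∃ A : Finset ι, A.card ≤ c x ∧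
      ∀ y ∈ D, (∀ i ∈ A, y i = x i) → f y = true) :
    ∃ T : DTree ι, Computes T f D ∧
      T.size ≤ 1 + ∑ x ∈ D.filter (fun x => f x = true), c x := by
  induction D using Finset.strongInduction with
  | H D ih =>
    by_cases h : ∃ x ∈ D, f x = true
    · obtain ⟨x, hx, hfx⟩ := h
      obtain ⟨A, hAc, hA⟩ := hc x hx hfx
      obtain ⟨T, hT, hTs⟩ := exists_computes_of_certificate f c D x
        (fun D' hD' hx' => ih D' ⟨hD', fun h => hx' (h hx)⟩ fun z hz hfz =>
          (hc z (hD' hz) hfz).imp fun B hB => ⟨hB.1, fun y hy => hB.2 y (hD' hy)⟩)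
        A D subset_rfl hA
      refine ⟨T, hT, ?_⟩
      have key := add_sum_erase (D.filter fun x => f x = true) c (mem_filter.2 ⟨hx, hfx⟩)
      have e : (D.erase x).filter (fun y => f y = true) =
          (D.filter fun y => f y = true).erase x := by
        ext y; simp only [mem_filter, mem_erase]; tauto
      rw [e] at hTs
      omega
    · refine ⟨.leaf false, fun y hy => ?_, by simp only [DTree.size]; omega⟩
      have : ¬ f y = true := fun hf => h ⟨y, hy, hf⟩
      simpa [DTree.eval] using this

theorem override_eq_self {ι : Type} {ρ : ι → Option Bool} {x : ι → Bool} (h : Consistent ρ x) :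
    override ρ x = x := by
  funext i
  cases hρ : ρ i with
  | none => simp [override, hρ]
  | some b => simp [override, hρ, h i b hρ]

/-- `Cert f D x` is the size of a set of coordinates on which `x` determines the value of `f`. -/
theorem exists_card_eq_cert {ι : Type} [Fintype ι] (f : (ι → Bool) → Bool)
    (D : Finset (ι → Bool)) {x : ι → Bool} (hx : x ∈ D) :
    ∃ A : Finset ι, A.card = Cert f D x ∧
      ∀ y ∈ D, (∀ i ∈ A, y i = x i) → f y = f x := by
  have hne : {k | ∃ ρ : ι → Option Bool, Consistent ρ x ∧
      IsConstOn (restrictF f ρ) (restrictD D ρ) ∧ resSize ρ = k}.Nonempty :=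
    ⟨_, fun i => some (x i), fun i b h => Option.some.inj h, fun y _ z _ => rfl, rfl⟩
  obtain ⟨ρ, hρ, hconst, hsize⟩ := Nat.sInf_mem hne
  refine ⟨univ.filter fun i => (ρ i).isSome, hsize, fun y hy hyx => ?_⟩
  have hρy : Consistent ρ y := fun i b h => by
    rw [hyx i (by simp [h]), hρ i b h]
  have := hconst y (by simpa [restrictD, override_eq_self hρy] using hy)
    x (by simpa [restrictD, override_eq_self hρ] using hx)
  simpa [restrictF, override_eq_self hρ, override_eq_self hρy] using this

/-- building a decision tree out of certificates: for a partial Boolean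
function `f : D → {0,1}`, `DT(f) ≤ 1 + Σ_{x ∈ f⁻¹(1)} Cert(f, x)`. -/
theorem stmt0 {n : ℕ} (D : Finset (Fin n → Bool)) (f : (Fin n → Bool) → Bool) :
    DTsize f D ≤ 1 + ∑ x ∈ D.filter (fun x => f x = true), Cert f D x := by
  obtain ⟨T, hT, hTs⟩ := exists_computes_size_le f (Cert f D) D fun x hx hfx => by
    obtain ⟨A, hA, hAf⟩ := exists_card_eq_cert f D hx
    exact ⟨A, hA.le, fun y hy h => (hAf y hy h).trans hfx⟩
  have hmem : T.size ∈ {s | ∃ T : DTree (Fin n), Computes T f D ∧ T.size = s} := ⟨T, hT, rfl⟩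
  exact (Nat.sInf_le hmem).trans hTs
end

section
/- Let D ⊆ {0,1}^n, let f : D → {0,1} be a partial Boolean function, let T be a decision tree, and let 𝒟_f be the canonical hard distribution for f. Then for every x ∈ f⁻¹(1), the conditional probability that T(z) ≠ f(z), where z ∼ 𝒟_f conditioned on x being the 1-input sampled in the first step of the experiment, is at least (1/2) · |Sens(f_{π(x)}, x)| / max{1, |Sens(f, x)|}, where π(x) is the restriction given by the path followed by x in T. -/
open Finset

attribute [local instance] Classical.propDecidable

/-- The error of `T` with respect to `f` under the canonical hard distribution `𝒟_f`
conditioned on the `1`-input `x` sampled in the first step of the experiment: the output is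
`x` with probability `1/2`, and a uniformly random sensitive neighbor of `x` with
probability `1/2`. -/
noncomputable def condErr {ι : Type} [Fintype ι] (T : DTree ι) (f : (ι → Bool) → Bool)
    (D : Finset (ι → Bool)) (x : ι → Bool) : ℝ :=
  (1 / 2) * (if T.eval x = f x then 0 else 1) +
  (1 / 2) * (∑ y ∈ sensSet f D x, if T.eval y = f y then (0 : ℝ) else 1) /
    max 1 ((sensSet f D x).card : ℝ)

theorem DTree.consistent_pathRes {ι : Type} (T : DTree ι) (x : ι → Bool) :
    Consistent (T.pathRes x) x := by
  induction T with
  | leaf b => intro i b h; simp [DTree.pathRes] at h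
  | node i t0 t1 ih0 ih1 =>
    intro j b h
    by_cases hj : j = i
    · subst hj
      simpa [DTree.pathRes] using h
    · rw [DTree.pathRes, Function.update_of_ne hj] at h
      split_ifs at h
      · exact ih1 j b h
      · exact ih0 j b h

theorem DTree.eval_eq_of_consistent_pathRes {ι : Type} (T : DTree ι) (x y : ι → Bool)
    (h : Consistent (T.pathRes x) y) : T.eval y = T.eval x := by
  induction T with
  | leaf b => rfl
  | node i t0 t1 ih0 ih1 =>
    have hi : y i = x i := h i (x i) (by simp [DTree.pathRes])
    have consistent_child : ∀ t : DTree ι,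
        (if x i then t1.pathRes x else t0.pathRes x) = t.pathRes x →
        Consistent (t.pathRes x) y := by
      intro t ht j b hb
      by_cases hj : j = i
      · subst hj
        rw [hi]
        exact t.consistent_pathRes x j b hb
      · refine h j b ?_
        rw [DTree.pathRes, Function.update_of_ne hj, ht]
        exact hb
    by_cases hx : x i = true
    · simp only [DTree.eval, hi, hx, if_true]
      exact ih1 (consistent_child t1 (by simp [hx]))
    · simp only [DTree.eval, hi, hx]
      exact ih0 (consistent_child t0 (by simp [hx]))

theorem ne_of_mem_sensSet {ι : Type} [Fintype ι] {f : (ι → Bool) → Bool}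
    {D : Finset (ι → Bool)} {x y : ι → Bool} (hy : y ∈ sensSet f D x) : f y ≠ f x :=
  (Finset.mem_filter.1 hy).2.2

/-- A sensitive neighbor of `x` under `f_ρ` agrees with `ρ`. -/
theorem consistent_of_mem_sensSet_restrict {ι : Type} [Fintype ι] {f : (ι → Bool) → Bool}
    {D : Finset (ι → Bool)} {ρ : ι → Option Bool} {x y : ι → Bool} (hx : Consistent ρ x)
    (hy : y ∈ sensSet (restrictF f ρ) (restrictD D ρ) x) : Consistent ρ y := by
  obtain ⟨-, ⟨i, rfl⟩, hne⟩ := Finset.mem_filter.1 hy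
  intro j b hj
  by_cases hji : j = i
  · subst hji
    refine absurd ?_ hne
    unfold restrictF
    congr 1
    funext k
    by_cases hk : k = j
    · subst hk
      simp [override, hj]
    · simp [override, flipBit, Function.update_of_ne hk]
  · rw [flipBit, Function.update_of_ne hji]
    exact hx j b hj

theorem sensSet_restrict_subset {ι : Type} [Fintype ι] {f : (ι → Bool) → Bool}
    {D : Finset (ι → Bool)} {ρ : ι → Option Bool} {x : ι → Bool} (hx : Consistent ρ x) :
    sensSet (restrictF f ρ) (restrictD D ρ) x ⊆ sensSet f D x := by
  intro y hy
  have hyρ := override_eq_self (consistent_of_mem_sensSet_restrict hx hy)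
  obtain ⟨hD, hi, hne⟩ := Finset.mem_filter.1 hy
  have hD' := (Finset.mem_filter.1 hD).2
  rw [hyρ] at hD'
  rw [restrictF, restrictF, hyρ, override_eq_self hx] at hne
  exact Finset.mem_filter.2 ⟨hD', hi, hne⟩

/-- for every `1`-input `x` of the partial function `f : D → {0,1}`, the
probability that `T(z) ≠ f(z)` where `z ∼ 𝒟_f` is conditioned on `x` being the `1`-input
sampled in the first step is at least
`(1/2) · |Sens(f_{π(x)}, x)| / max{1, |Sens(f, x)|}`. -/
theorem stmt2 {n : ℕ} (D : Finset (Fin n → Bool)) (f : (Fin n → Bool) → Bool)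
    (T : DTree (Fin n)) (x : Fin n → Bool) (hxD : x ∈ D) (hfx : f x = true) :
    (1 / 2 : ℝ) *
        ((sensSet (restrictF f (T.pathRes x)) (restrictD D (T.pathRes x)) x).card : ℝ) /
        max 1 ((sensSet f D x).card : ℝ)
      ≤ condErr T f D x := by
  have hx := T.consistent_pathRes x
  set S := sensSet (restrictF f (T.pathRes x)) (restrictD D (T.pathRes x)) x with hS
  have hsub : S ⊆ sensSet f D x := sensSet_restrict_subset hx
  have hm : (0 : ℝ) < max 1 ((sensSet f D x).card : ℝ) := lt_max_of_lt_left one_pos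
  have hnonneg : ∀ y ∈ sensSet f D x, (0 : ℝ) ≤ if T.eval y = f y then (0 : ℝ) else 1 := by
    intro y _
    split_ifs <;> norm_num
  unfold condErr
  by_cases hT : T.eval x = f x
  · have hsum : (S.card : ℝ) ≤ ∑ y ∈ sensSet f D x, if T.eval y = f y then (0 : ℝ) else 1 := by
      calc (S.card : ℝ) = ∑ y ∈ S, if T.eval y = f y then (0 : ℝ) else 1 := by
            rw [Finset.card_eq_sum_ones, Nat.cast_sum]
            refine Finset.sum_congr rfl fun y hy => ?_
            have hev := T.eval_eq_of_consistent_pathRes x y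
              (consistent_of_mem_sensSet_restrict hx hy)
            have hne := ne_of_mem_sensSet (hsub hy)
            rw [if_neg (by rw [hev, hT]; exact hne.symm), Nat.cast_one]
        _ ≤ _ := Finset.sum_le_sum_of_subset_of_nonneg hsub fun y hy _ => hnonneg y hy
    rw [if_pos hT, mul_zero, zero_add]
    gcongr
  · have hcard : (S.card : ℝ) ≤ max 1 ((sensSet f D x).card : ℝ) :=
      le_max_of_le_right (by exact_mod_cast Finset.card_le_card hsub)
    have hle : (1 / 2 : ℝ) * S.card / max 1 ((sensSet f D x).card : ℝ) ≤ 1 / 2 := by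
      rw [div_le_iff₀ hm]
      gcongr
    rw [if_neg hT, mul_one]
    exact hle.trans (le_add_of_nonneg_right
      (div_nonneg (mul_nonneg (by norm_num) (Finset.sum_nonneg hnonneg)) hm.le))
end

section
/- Let f^{(1)}, …, f^{(r)} be partial Boolean functions, f^{(i)} : D^{(i)} → {0,1} with D^{(i)} ⊆ {0,1}^{n^{(i)}}, over disjoint sets of variables. Then the decision tree complexity of the partial function f^{(1)} ⊕ ⋯ ⊕ f^{(r)} : D^{(1)} × ⋯ × D^{(r)} → {0,1}, (x^{(1)},…,x^{(r)}) ↦ f^{(1)}(x^{(1)}) ⊕ ⋯ ⊕ f^{(r)}(x^{(r)}), satisfies DT(f^{(1)} ⊕ ⋯ ⊕ f^{(r)}) = Π_{i=1}^r DT(f^{(i)}). -/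
open Finset

attribute [local instance] Classical.propDecidable

/-- XOR of a finite family of bits. -/
noncomputable def xorAll {r : ℕ} (g : Fin r → Bool) : Bool :=
  decide (Odd (Finset.univ.filter fun i => g i = true).card)

namespace DTree

/-- Replace every leaf labeled `b` of a tree by the tree `k b`. -/
def graft {ι : Type} : DTree ι → (Bool → DTree ι) → DTree ι
  | .leaf b, k => k b
  | .node i t0 t1, k => .node i (t0.graft k) (t1.graft k)

/-- Rename the queried coordinates along `e`. -/
def rename {ι κ : Type} (e : ι → κ) : DTree ι → DTree κ
  | .leaf b => .leaf b
  | .node i t0 t1 => .node (e i) (t0.rename e) (t1.rename e)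

theorem eval_graft {ι : Type} (T : DTree ι) (k : Bool → DTree ι) (x : ι → Bool) :
    (T.graft k).eval x = (k (T.eval x)).eval x := by
  induction T with
  | leaf b => rfl
  | node i t0 t1 h0 h1 => simp only [graft, eval, h0, h1]; split <;> rfl

theorem size_graft {ι : Type} (T : DTree ι) (k : Bool → DTree ι) (c : ℕ)
    (hk : ∀ b, (k b).size = c) : (T.graft k).size = T.size * c := by
  induction T with
  | leaf b => simp [graft, size, hk]
  | node i t0 t1 h0 h1 => simp only [graft, size, h0, h1, add_mul]

theorem eval_rename {ι κ : Type} (e : ι → κ) (T : DTree ι) (x : κ → Bool) :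
    (T.rename e).eval x = T.eval fun j => x (e j) := by
  induction T with
  | leaf b => rfl
  | node i t0 t1 h0 h1 => simp only [rename, eval, h0, h1]

theorem size_rename {ι κ : Type} (e : ι → κ) (T : DTree ι) : (T.rename e).size = T.size := by
  induction T with
  | leaf b => rfl
  | node i t0 t1 h0 h1 => simp only [rename, size, h0, h1]

end DTree

theorem Computes.node {ι : Type} {f : (ι → Bool) → Bool} {D : Finset (ι → Bool)} {j : ι}
    {t0 t1 : DTree ι} (h0 : Computes t0 f (D.filter fun x => x j = false))
    (h1 : Computes t1 f (D.filter fun x => x j = true)) : Computes (.node j t0 t1) f D := by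
  intro x hx
  cases hj : x j
  · simpa [DTree.eval, hj] using h0 x (by simp [hx, hj])
  · simpa [DTree.eval, hj] using h1 x (by simp [hx, hj])

theorem exists_computes {ι : Type} (f : (ι → Bool) → Bool) (D : Finset (ι → Bool)) :
    ∃ T, Computes T f D := by
  induction D using Finset.strongInduction with
  | H D ih =>
    by_cases h : IsConstOn f D
    · obtain rfl | ⟨y, hy⟩ := D.eq_empty_or_nonempty
      · exact ⟨.leaf true, fun x hx => by simp at hx⟩
      · exact ⟨.leaf (f y), fun x hx => h y hy x hx⟩
    · simp only [IsConstOn, not_forall] at h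
      obtain ⟨x, hx, y, hy, hxy⟩ := h
      obtain ⟨j, hj⟩ := Function.ne_iff.mp (fun e : x = y => hxy (congrArg f e))
      have hlt (b : Bool) : (D.filter fun z => z j = b) ⊂ D := by
        rw [Finset.filter_ssubset]
        by_cases hb : x j = b
        · exact ⟨y, hy, fun e => hj (hb.trans e.symm)⟩
        · exact ⟨x, hx, hb⟩
      obtain ⟨t0, h0⟩ := ih _ (hlt false)
      obtain ⟨t1, h1⟩ := ih _ (hlt true)
      exact ⟨.node j t0 t1, h0.node h1⟩

theorem exists_computes_size_eq_DTsize {ι : Type} (f : (ι → Bool) → Bool)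
    (D : Finset (ι → Bool)) : ∃ T, Computes T f D ∧ T.size = DTsize f D := by
  obtain ⟨T, hT⟩ := exists_computes f D
  exact Nat.sInf_mem (s := {s | ∃ T : DTree ι, Computes T f D ∧ T.size = s}) ⟨_, T, hT, rfl⟩

theorem DTsize_le {ι : Type} {f : (ι → Bool) → Bool} {D : Finset (ι → Bool)} {T : DTree ι}
    (h : Computes T f D) : DTsize f D ≤ T.size :=
  Nat.sInf_le ⟨T, h, rfl⟩

theorem DTsize_le_add {ι : Type} (f : (ι → Bool) → Bool) (D : Finset (ι → Bool)) (j : ι) :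
    DTsize f D ≤ DTsize f (D.filter fun x => x j = false)
      + DTsize f (D.filter fun x => x j = true) := by
  obtain ⟨t0, h0, e0⟩ := exists_computes_size_eq_DTsize f (D.filter fun x => x j = false)
  obtain ⟨t1, h1, e1⟩ := exists_computes_size_eq_DTsize f (D.filter fun x => x j = true)
  rw [← e0, ← e1]
  exact DTsize_le (h0.node h1)

theorem DTsize_le_one_of_isConstOn {ι : Type} {f : (ι → Bool) → Bool} {D : Finset (ι → Bool)}
    (hD : D.Nonempty) (h : IsConstOn f D) : DTsize f D ≤ 1 := by
  obtain ⟨y, hy⟩ := hD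
  exact DTsize_le (T := .leaf (f y)) fun x hx => h y hy x hx

/-- XOR of the bits indexed by a finite set. -/
noncomputable def xorOver {α : Type} (s : Finset α) (g : α → Bool) : Bool :=
  decide (Odd (s.filter fun i => g i = true).card)

theorem xorOver_insert {α : Type} [DecidableEq α] {s : Finset α} {a : α} (ha : a ∉ s)
    (g : α → Bool) :
    xorOver (insert a s) g = (g a ^^ xorOver s g) := by
  unfold xorOver
  rw [Finset.filter_insert]
  cases h : g a
  · simp
  · simp [ha, Nat.odd_add_one, -Nat.not_odd_iff_even]

theorem xorOver_congr {α : Type} {s : Finset α} {g h : α → Bool} (e : ∀ i ∈ s, g i = h i) :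
    xorOver s g = xorOver s h := by
  unfold xorOver
  rw [Finset.filter_congr fun i hi => by rw [e i hi]]

theorem xorAll_eq_xor_erase {r : ℕ} (g : Fin r → Bool) (i : Fin r) :
    xorAll g = (g i ^^ xorOver (Finset.univ.erase i) g) := by
  rw [← xorOver_insert (Finset.notMem_erase i _), Finset.insert_erase (Finset.mem_univ i)]
  rfl

theorem exists_tree_xorOver {r : ℕ} {ι : Fin r → Type} (T : ∀ i, DTree (ι i))
    (s : Finset (Fin r)) : ∃ S : DTree ((i : Fin r) × ι i),
      (∀ z, S.eval z = xorOver s fun i => (T i).eval fun j => z ⟨i, j⟩) ∧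
      S.size = ∏ i ∈ s, (T i).size := by
  induction s using Finset.induction_on with
  | empty => exact ⟨.leaf false, fun z => by simp [xorOver, DTree.eval], rfl⟩
  | insert a s ha ih =>
    obtain ⟨S, hS, hsize⟩ := ih
    refine ⟨((T a).rename (Sigma.mk a)).graft fun b => S.graft fun c => .leaf (b ^^ c),
      fun z => ?_, ?_⟩
    · rw [xorOver_insert ha]
      simp only [DTree.eval_graft, DTree.eval_rename, hS, DTree.eval]
    · rw [Finset.prod_insert ha, ← hsize,
        DTree.size_graft _ _ S.size fun b => by rw [DTree.size_graft _ _ 1 fun _ => rfl, mul_one],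
        DTree.size_rename]

theorem isConstOn_of_xorAll_eq {r : ℕ} {ι : Fin r → Type} {f : ∀ i, (ι i → Bool) → Bool}
    {D : ∀ i, Finset (ι i → Bool)} (hD : ∀ i, (D i).Nonempty) {b : Bool}
    (h : ∀ x : ∀ i, ι i → Bool, (∀ i, x i ∈ D i) → b = xorAll fun i => f i (x i))
    (i : Fin r) : IsConstOn (f i) (D i) := by
  choose w hw using hD
  have key (x) (hx : x ∈ D i) :
      b = (f i x ^^ xorOver (Finset.univ.erase i) fun k => f k (w k)) := by
    rw [h (Function.update w i x) fun k => ?_, xorAll_eq_xor_erase _ i]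
    · congr 1
      · simp
      · refine xorOver_congr fun k hk => ?_
        rw [Function.update_of_ne (Finset.ne_of_mem_erase hk)]
    · obtain rfl | hk := eq_or_ne k i
      · simpa using hx
      · simpa [hk] using hw k
  intro x hx y hy
  exact Bool.xor_left_inj.mp ((key x hx).symm.trans (key y hy))

theorem prod_DTsize_update {r : ℕ} {ι : Fin r → Type} (f : ∀ i, (ι i → Bool) → Bool)
    (D : ∀ i, Finset (ι i → Bool)) (i : Fin r) (E : Finset (ι i → Bool)) :
    ∏ k, DTsize (f k) (Function.update D i E k)
      = DTsize (f i) E * ∏ k ∈ Finset.univ.erase i, DTsize (f k) (D k) := by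
  rw [← Finset.mul_prod_erase _ _ (Finset.mem_univ i), Function.update_self]
  congr 1
  refine Finset.prod_congr rfl fun k hk => ?_
  rw [Function.update_of_ne (Finset.ne_of_mem_erase hk)]

theorem prod_DTsize_le_size {r : ℕ} {ι : Fin r → Type} (f : ∀ i, (ι i → Bool) → Bool)
    (T : DTree ((i : Fin r) × ι i)) (D : ∀ i, Finset (ι i → Bool)) (hD : ∀ i, (D i).Nonempty)
    (hT : ∀ x : ∀ i, ι i → Bool, (∀ i, x i ∈ D i) →
      T.eval (fun p => x p.1 p.2) = xorAll fun i => f i (x i)) :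
    ∏ i, DTsize (f i) (D i) ≤ T.size := by
  induction T generalizing D with
  | leaf b =>
    exact Finset.prod_le_one' fun i _ =>
      DTsize_le_one_of_isConstOn (hD i) (isConstOn_of_xorAll_eq hD hT i)
  | node p t0 t1 ih0 ih1 =>
    obtain ⟨i, j⟩ := p
    simp only [DTree.eval] at hT
    simp only [DTree.size]
    have hne (b : Bool) (hb : ((D i).filter fun x => x j = b).Nonempty) (k : Fin r) :
        (Function.update D i ((D i).filter fun x => x j = b) k).Nonempty := by
      obtain rfl | hk := eq_or_ne k i
      · simpa using hb
      · simpa [hk] using hD k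
    have hmem (b : Bool) (x : ∀ i, ι i → Bool)
        (hx : ∀ k, x k ∈ Function.update D i ((D i).filter fun x => x j = b) k) :
        (∀ k, x k ∈ D k) ∧ x i j = b := by
      have hi := hx i
      rw [Function.update_self, Finset.mem_filter] at hi
      refine ⟨fun k => ?_, hi.2⟩
      obtain rfl | hk := eq_or_ne k i
      · exact hi.1
      · simpa [hk] using hx k
    by_cases h0 : ((D i).filter fun x => x j = false).Nonempty
    · by_cases h1 : ((D i).filter fun x => x j = true).Nonempty
      · have l0 := ih0 _ (hne false h0) fun x hx => by
          simpa [(hmem _ x hx).2] using hT x (hmem _ x hx).1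
        have l1 := ih1 _ (hne true h1) fun x hx => by
          simpa [(hmem _ x hx).2] using hT x (hmem _ x hx).1
        rw [prod_DTsize_update] at l0 l1
        rw [← Finset.mul_prod_erase _ _ (Finset.mem_univ i)]
        refine (Nat.mul_le_mul_right _ (DTsize_le_add (f i) (D i) j)).trans ?_
        rw [add_mul]
        exact add_le_add l0 l1
      · rw [Finset.not_nonempty_iff_eq_empty, Finset.filter_eq_empty_iff] at h1
        refine (ih0 D hD fun x hx => ?_).trans (Nat.le_add_right _ _)
        simpa [h1 (hx i)] using hT x hx
    · rw [Finset.not_nonempty_iff_eq_empty, Finset.filter_eq_empty_iff] at h0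
      refine (ih1 D hD fun x hx => ?_).trans (Nat.le_add_left _ _)
      simpa [h0 (hx i)] using hT x hx

/-- generalization of Savický: for partial Boolean functions
`f⁽¹⁾, …, f⁽ʳ⁾` over disjoint sets of variables,
`DT(f⁽¹⁾ ⊕ ⋯ ⊕ f⁽ʳ⁾) = Π_{i=1}^r DT(f⁽ⁱ⁾)`. -/
theorem stmt4 (r : ℕ) (hr : 1 ≤ r) (ι : Fin r → Type) [∀ i, Fintype (ι i)]
    (f : ∀ i, (ι i → Bool) → Bool) (D : ∀ i, Finset (ι i → Bool))
    (hD : ∀ i, (D i).Nonempty) :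
    DTsize (fun z : ((i : Fin r) × ι i) → Bool => xorAll fun i => f i fun j => z ⟨i, j⟩)
      (Finset.univ.filter fun z : ((i : Fin r) × ι i) → Bool => ∀ i, (fun j => z ⟨i, j⟩) ∈ D i)
    = ∏ i, DTsize (f i) (D i) := by
  apply le_antisymm
  · choose T hT hsize using fun i => exists_computes_size_eq_DTsize (f i) (D i)
    obtain ⟨S, hS, hSsize⟩ := exists_tree_xorOver T Finset.univ
    rw [← Finset.prod_congr rfl fun i _ => hsize i, ← hSsize]
    refine DTsize_le fun z hz => ?_
    rw [hS]
    exact xorOver_congr fun i _ => hT i _ ((Finset.mem_filter.mp hz).2 i)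
  · obtain ⟨T, hT, hsize⟩ := exists_computes_size_eq_DTsize
      (fun z : ((i : Fin r) × ι i) → Bool => xorAll fun i => f i fun j => z ⟨i, j⟩)
      (Finset.univ.filter fun z : ((i : Fin r) × ι i) → Bool => ∀ i, (fun j => z ⟨i, j⟩) ∈ D i)
    rw [← hsize]
    exact prod_DTsize_le_size f T D hD fun x hx =>
      hT (fun p => x p.1 p.2) (Finset.mem_filter.mpr ⟨Finset.mem_univ _, hx⟩)
end

section
/- Let G be an n-vertex, m-edge graph in which every vertex cover has size at least k', and let ℓ ≥ 1. Then any decision tree T that computes the partial function ℓ-IsEdge_G : ℓ-D_G → {0,1} (i.e., agrees with ℓ-IsEdge_G on every point of ℓ-D_G) has size |T| ≥ (ℓ+1)(k'+m). -/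
open Finset

attribute [local instance] Classical.propDecidable

/-- The edge set of `G` as a `Finset`. -/
noncomputable def edgeFin {V : Type} [Fintype V] (G : SimpleGraph V) : Finset (Sym2 V) :=
  Finset.univ.filter fun e => e ∈ G.edgeSet

/-- `K` is a vertex cover of `G`: every edge has at least one endpoint in `K`. -/
def IsVC {V : Type} (G : SimpleGraph V) (K : Finset V) : Prop :=
  ∀ e ∈ G.edgeSet, ∃ v ∈ K, v ∈ e

/-- The generalized edge indicator `ℓ-Ind[e] = (Ind[e], …, Ind[e])`, viewed as an element of
`{0,1}^{(ℓ+1) × n}` (block `0` is `v⁽⁰⁾` and blocks `1, …, ℓ` are `v⁽¹⁾, …, v⁽ˡ⁾`). -/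
noncomputable def ellInd {n : ℕ} (ℓ : ℕ) (e : Sym2 (Fin n)) : Fin (ℓ + 1) × Fin n → Bool :=
  fun p => decide (p.2 ∈ e)

/-- The `ℓ`-amplified edge indicator function `ℓ-IsEdge_G` (a total function). -/
noncomputable def ellIsEdge {n : ℕ} (G : SimpleGraph (Fin n)) (ℓ : ℕ)
    (z : Fin (ℓ + 1) × Fin n → Bool) : Bool :=
  decide ((∃ e ∈ G.edgeSet, ∀ i : Fin n, z (0, i) = decide (i ∈ e)) ∧
    (∀ i : Fin n, z (0, i) = true → ∀ j : Fin (ℓ + 1), z (j, i) = true))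

/-- `ℓ-D_G`: all generalized edge indicators together with all strings obtained from one of
them by flipping exactly one `1`-coordinate to `0`. -/
noncomputable def ellDom {n : ℕ} (G : SimpleGraph (Fin n)) (ℓ : ℕ) :
    Finset (Fin (ℓ + 1) × Fin n → Bool) :=
  Finset.univ.filter fun z => ∃ e ∈ G.edgeSet,
    z = ellInd ℓ e ∨ ∃ p, ellInd ℓ e p = true ∧ z = Function.update (ellInd ℓ e) p false

/-- The canonical hard distribution `ℓ-𝒟_G` (as a probability mass function): sample a
generalized edge indicator `ℓ-Ind[e]` uniformly at random; with probability `1/2` output it,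
and with probability `1/2` output it with a uniformly random one of its `2(ℓ+1)` many
`1`-coordinates flipped to `0`. -/
noncomputable def ellDist {n : ℕ} (G : SimpleGraph (Fin n)) (ℓ : ℕ)
    (z : Fin (ℓ + 1) × Fin n → Bool) : ℝ :=
  (∑ e ∈ edgeFin G, ((if z = ellInd ℓ e then (1 : ℝ) / 2 else 0) +
      ∑ p : Fin (ℓ + 1) × Fin n,
        if ellInd ℓ e p = true ∧ z = Function.update (ellInd ℓ e) p false
          then 1 / (4 * (ℓ + 1)) else 0)) / (edgeFin G).card

namespace DTree

/-- The internal nodes of a decision tree, each recorded as the list of query-answer pairs on the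
path from the root, together with the coordinate it queries. -/
noncomputable def nodes {ι : Type} : DTree ι → Finset (List (ι × Bool) × ι)
  | .leaf _ => ∅
  | .node i t0 t1 => insert ([], i)
      (t0.nodes.image (fun a => ((i, false) :: a.1, a.2)) ∪
        t1.nodes.image (fun a => ((i, true) :: a.1, a.2)))

theorem card_nodes_lt_size {ι : Type} (T : DTree ι) : T.nodes.card < T.size := by
  induction T with
  | leaf b => simp [nodes, size]
  | node i t0 t1 h0 h1 =>
    have h := Finset.card_insert_le (([], i) : List (ι × Bool) × ι)
      (t0.nodes.image (fun a => ((i, false) :: a.1, a.2)) ∪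
        t1.nodes.image (fun a => ((i, true) :: a.1, a.2)))
    have hu := Finset.card_union_le (t0.nodes.image (fun a => ((i, false) :: a.1, a.2)))
      (t1.nodes.image (fun a => ((i, true) :: a.1, a.2)))
    have h0' := Finset.card_image_le (s := t0.nodes) (f := fun a => ((i, false) :: a.1, a.2))
    have h1' := Finset.card_image_le (s := t1.nodes) (f := fun a => ((i, true) :: a.1, a.2))
    simp only [nodes, size]
    omega

/-- The node of `T` with path `a.1` is where the computation on `x` first queries `a.2`. -/
structure IsFirstQuery {ι : Type} (T : DTree ι) (x : ι → Bool) (a : List (ι × Bool) × ι) :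
    Prop where
  mem_nodes : a ∈ T.nodes
  consistent : ∀ q ∈ a.1, x q.1 = q.2
  fresh : a.2 ∉ a.1.map Prod.fst

theorem mem_nodes_node {ι : Type} {i : ι} {t0 t1 : DTree ι} {a : List (ι × Bool) × ι} :
    a ∈ (DTree.node i t0 t1).nodes ↔ a = ([], i) ∨
      ∃ b L, a.1 = (i, b) :: L ∧ (L, a.2) ∈ (if b then t1 else t0).nodes := by
  obtain ⟨M, p⟩ := a
  simp only [nodes, Finset.mem_insert, Finset.mem_union, Finset.mem_image, Prod.mk.injEq,
    Prod.exists]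
  constructor
  · rintro (h | ⟨L, q, h, rfl, rfl⟩ | ⟨L, q, h, rfl, rfl⟩)
    · exact .inl h
    · exact .inr ⟨false, L, rfl, by simpa using h⟩
    · exact .inr ⟨true, L, rfl, by simpa using h⟩
  · rintro (h | ⟨b, L, rfl, h⟩)
    · exact .inl h
    · cases b
      · exact .inr (.inl ⟨L, p, by simpa using h, rfl, rfl⟩)
      · exact .inr (.inr ⟨L, p, by simpa using h, rfl, rfl⟩)

theorem eval_node {ι : Type} {i : ι} {t0 t1 : DTree ι} (x : ι → Bool) :
    (DTree.node i t0 t1).eval x = (if x i then t1 else t0).eval x := by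
  cases h : x i <;> simp [eval, h]

theorem exists_isFirstQuery {ι : Type} [DecidableEq ι] (T : DTree ι) {x : ι → Bool} {p : ι} {b : Bool}
    (h : T.eval x ≠ T.eval (Function.update x p b)) : ∃ L, T.IsFirstQuery x (L, p) := by
  induction T with
  | leaf c => simp [eval] at h
  | node i t0 t1 h0 h1 =>
    by_cases hp : p = i
    · subst hp
      exact ⟨[], mem_nodes_node.2 (.inl rfl), by simp, by simp⟩
    · have hi : Function.update x p b i = x i := Function.update_of_ne (Ne.symm hp) _ _
      rw [eval_node, eval_node, hi] at h
      have key : ∃ L, (if x i then t1 else t0).IsFirstQuery x (L, p) := by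
        cases hx : x i
        · simpa using h0 (by simpa [hx] using h)
        · simpa using h1 (by simpa [hx] using h)
      obtain ⟨L, hL⟩ := key
      refine ⟨(i, x i) :: L, mem_nodes_node.2 (.inr ⟨x i, L, rfl, hL.mem_nodes⟩), ?_, ?_⟩
      · have := hL.consistent
        simpa using this
      · have := hL.fresh
        simp_all

/-- Of two distinct coordinates, exactly one is queried before the other. -/
theorem IsFirstQuery.mem_iff_notMem {ι : Type} {T : DTree ι} {x : ι → Bool} {p q : ι}
    {L M : List (ι × Bool)} (hp : T.IsFirstQuery x (L, p)) (hq : T.IsFirstQuery x (M, q))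
    (hpq : p ≠ q) : q ∈ L.map Prod.fst ↔ p ∉ M.map Prod.fst := by
  induction T generalizing L M with
  | leaf c => simpa [nodes] using hp.mem_nodes
  | node i t0 t1 h0 h1 =>
    obtain ⟨mp, cp, fp⟩ := hp
    obtain ⟨mq, cq, fq⟩ := hq
    rw [mem_nodes_node] at mp mq
    rcases mp with mp | ⟨b, L', rfl, mp⟩ <;> rcases mq with mq | ⟨c, M', rfl, mq⟩
    · simp_all
    · simp_all
    · simp_all
    · have hb : x i = b := cp (i, b) (by simp)
      have hc : x i = c := cq (i, c) (by simp)
      have cp' : ∀ r ∈ L', x r.1 = r.2 := fun r hr => cp r (List.mem_cons_of_mem _ hr)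
      have cq' : ∀ r ∈ M', x r.1 = r.2 := fun r hr => cq r (List.mem_cons_of_mem _ hr)
      simp only [List.map_cons, List.mem_cons, not_or] at fp fq ⊢
      have key : q ∈ L'.map Prod.fst ↔ p ∉ M'.map Prod.fst := by
        subst hb
        subst hc
        cases hx : x i <;> simp only [hx, if_true, Bool.false_eq_true, if_false] at mp mq
        · exact h0 ⟨mp, cp', fp.2⟩ ⟨mq, cq', fq.2⟩
        · exact h1 ⟨mp, cp', fp.2⟩ ⟨mq, cq', fq.2⟩
      simp [fp.1, fq.1, key]

/-- Inputs reaching a common node agree on the coordinates queried above it. -/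
theorem IsFirstQuery.apply_eq {ι : Type} {T : DTree ι} {x y : ι → Bool}
    {a : List (ι × Bool) × ι} (hx : T.IsFirstQuery x a) (hy : T.IsFirstQuery y a) {q : ι}
    (hq : q ∈ a.1.map Prod.fst) : x q = y q := by
  obtain ⟨r, hr, rfl⟩ := List.mem_map.1 hq
  rw [hx.consistent r hr, hy.consistent r hr]

end DTree

section IsEdge

variable {n : ℕ} {G : SimpleGraph (Fin n)} {ℓ : ℕ}

theorem ellInd_mem_ellDom {e : Sym2 (Fin n)} (he : e ∈ G.edgeSet) : ellInd ℓ e ∈ ellDom G ℓ :=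
  Finset.mem_filter.2 ⟨Finset.mem_univ _, e, he, .inl rfl⟩

theorem update_ellInd_mem_ellDom {e : Sym2 (Fin n)} (he : e ∈ G.edgeSet)
    {p : Fin (ℓ + 1) × Fin n} (hp : p.2 ∈ e) :
    Function.update (ellInd ℓ e) p false ∈ ellDom G ℓ :=
  Finset.mem_filter.2 ⟨Finset.mem_univ _, e, he, .inr ⟨p, by simpa [ellInd] using hp, rfl⟩⟩

theorem ellIsEdge_ellInd {e : Sym2 (Fin n)} (he : e ∈ G.edgeSet) :
    ellIsEdge G ℓ (ellInd ℓ e) = true := by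
  simp only [ellIsEdge, decide_eq_true_eq]
  exact ⟨⟨e, he, fun i => by simp [ellInd]⟩, fun i hi j => hi⟩

theorem ellIsEdge_update_ellInd {e : Sym2 (Fin n)}
    {p : Fin (ℓ + 1) × Fin n} (hp : p.2 ∈ e) :
    ellIsEdge G ℓ (Function.update (ellInd ℓ e) p false) = false := by
  obtain ⟨j, v⟩ := p
  simp only [ellIsEdge, decide_eq_false_iff_not, not_and]
  rintro ⟨f, hf, hfe⟩ h
  by_cases hj : j = 0
  · subst hj
    have hvf : v ∉ f := by simpa using hfe v
    have hsub : ∀ i ∈ f, i ∈ e := by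
      intro i hi
      have hiv : i ≠ v := fun hiv => hvf (hiv ▸ hi)
      simpa [Function.update_of_ne, hiv, hi, ellInd] using hfe i
    induction f with
    | h a b =>
      have hab : a ≠ b := G.ne_of_adj hf
      have hef : e = s(a, b) :=
        (Sym2.mem_and_mem_iff hab).1 ⟨hsub a (by simp), hsub b (by simp)⟩
      exact hvf (hef ▸ hp)
  · have := h v (by
      rw [Function.update_of_ne (by simp [Ne.symm hj])]
      simpa [ellInd] using hp) j
    simp at this

variable {T : DTree (Fin (ℓ + 1) × Fin n)}

theorem exists_isFirstQuery_ellInd (hT : ∀ z ∈ ellDom G ℓ, T.eval z = ellIsEdge G ℓ z)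
    {e : Sym2 (Fin n)} (he : e ∈ G.edgeSet) {v : Fin n} (hv : v ∈ e) (j : Fin (ℓ + 1)) :
    ∃ L, T.IsFirstQuery (ellInd ℓ e) (L, (j, v)) := by
  apply T.exists_isFirstQuery (b := false)
  rw [hT _ (ellInd_mem_ellDom he), hT _ (update_ellInd_mem_ellDom (p := (j, v)) he hv),
    ellIsEdge_ellInd he, ellIsEdge_update_ellInd (p := (j, v)) hv]
  simp

/-- `e = s(u, v)` is an edge whose computation path first queries its endpoint `v` in block `j` at
the node `a`, where `a.2 = (j, v)`. -/
structure IsEdgeQuery (G : SimpleGraph (Fin n)) (T : DTree (Fin (ℓ + 1) × Fin n))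
    (a : List ((Fin (ℓ + 1) × Fin n) × Bool) × (Fin (ℓ + 1) × Fin n)) (u : Fin n) : Prop where
  adj : G.Adj u a.2.2
  isFirstQuery : T.IsFirstQuery (ellInd ℓ s(u, a.2.2)) a

theorem exists_isEdgeQuery_pair (hT : ∀ z ∈ ellDom G ℓ, T.eval z = ellIsEdge G ℓ z)
    {e : Sym2 (Fin n)} (he : e ∈ G.edgeSet) (j : Fin (ℓ + 1)) :
    ∃ u v L M, e = s(u, v) ∧ IsEdgeQuery G T (L, (j, u)) v ∧ IsEdgeQuery G T (M, (j, v)) u ∧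
      (j, v) ∉ L.map Prod.fst ∧ (j, u) ∈ M.map Prod.fst := by
  induction e with
  | h u v =>
    have huv : G.Adj u v := he
    obtain ⟨L, hL⟩ := exists_isFirstQuery_ellInd hT he (v := u) (by simp) j
    obtain ⟨M, hM⟩ := exists_isFirstQuery_ellInd hT he (v := v) (by simp) j
    have hiff := hL.mem_iff_notMem hM (by simp [huv.ne])
    have hLu : IsEdgeQuery G T (L, (j, u)) v := ⟨huv.symm, by simpa [Sym2.eq_swap] using hL⟩
    have hMv : IsEdgeQuery G T (M, (j, v)) u := ⟨huv, hM⟩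
    by_cases h : (j, v) ∈ L.map Prod.fst
    · exact ⟨v, u, M, L, Sym2.eq_swap, hMv, hLu, hiff.1 h, h⟩
    · exact ⟨u, v, L, M, rfl, hLu, hMv, h, not_not.1 (mt hiff.2 h)⟩

/-- If the other endpoint has been queried above a node, it is determined by the node. -/
theorem IsEdgeQuery.eq_of_mem
    {a : List ((Fin (ℓ + 1) × Fin n) × Bool) × (Fin (ℓ + 1) × Fin n)} {u w : Fin n}
    (hu : IsEdgeQuery G T a u) (hw : IsEdgeQuery G T a w)
    (h : (a.2.1, u) ∈ a.1.map Prod.fst) : w = u := by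
  have := hu.isFirstQuery.apply_eq hw.isFirstQuery h
  have huv := hu.adj.ne
  simp only [ellInd, Sym2.mem_iff, decide_true, eq_comm (a := true),
    decide_eq_true_eq, huv, or_false] at this
  exact this.symm

/-- The nodes at which some edge has its first endpoint queried in the block of the node. -/
noncomputable def firstEndpointNodes (G : SimpleGraph (Fin n))
    (T : DTree (Fin (ℓ + 1) × Fin n)) :=
  T.nodes.filter fun a => ∃ u, IsEdgeQuery G T a u ∧ (a.2.1, u) ∉ a.1.map Prod.fst

/-- The nodes at which some edge has its second endpoint queried in the block of the node. -/
noncomputable def secondEndpointNodes (G : SimpleGraph (Fin n))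
    (T : DTree (Fin (ℓ + 1) × Fin n)) :=
  T.nodes.filter fun a => ∃ u, IsEdgeQuery G T a u ∧ (a.2.1, u) ∈ a.1.map Prod.fst

theorem disjoint_endpointNodes :
    Disjoint (firstEndpointNodes G T) (secondEndpointNodes G T) := by
  refine Finset.disjoint_filter.2 ?_
  rintro a - ⟨u, hu, hu'⟩ ⟨w, hw, hw'⟩
  exact hu' (hw.eq_of_mem hu hw' ▸ hw')

theorem mul_le_card_firstEndpointNodes {k : ℕ}
    (hvc : ∀ K : Finset (Fin n), IsVC G K → k ≤ K.card)
    (hT : ∀ z ∈ ellDom G ℓ, T.eval z = ellIsEdge G ℓ z) :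
    (ℓ + 1) * k ≤ (firstEndpointNodes G T).card := by
  have hfib : ∀ j ∈ (Finset.univ : Finset (Fin (ℓ + 1))),
      k ≤ ((firstEndpointNodes G T).filter fun a => a.2.1 = j).card := by
    intro j _
    refine (hvc (((firstEndpointNodes G T).filter fun a => a.2.1 = j).image fun a => a.2.2)
      ?_).trans Finset.card_image_le
    intro e he
    obtain ⟨u, v, L, M, rfl, hL, -, h, -⟩ := exists_isEdgeQuery_pair hT he j
    refine ⟨u, Finset.mem_image.2 ⟨(L, (j, u)), ?_, rfl⟩, by simp⟩
    exact Finset.mem_filter.2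
      ⟨Finset.mem_filter.2 ⟨hL.isFirstQuery.mem_nodes, v, hL, h⟩, rfl⟩
  have hmap : ∀ a ∈ firstEndpointNodes G T, a.2.1 ∈ (Finset.univ : Finset (Fin (ℓ + 1))) :=
    fun _ _ => Finset.mem_univ _
  simpa [mul_comm] using Finset.mul_card_image_le_card_of_maps_to hmap k hfib

theorem mul_le_card_secondEndpointNodes
    (hT : ∀ z ∈ ellDom G ℓ, T.eval z = ellIsEdge G ℓ z) :
    (ℓ + 1) * (edgeFin G).card ≤ (secondEndpointNodes G T).card := by
  have := Finset.card_le_card_of_forall_subsingleton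
    (s := (Finset.univ : Finset (Fin (ℓ + 1))) ×ˢ edgeFin G) (t := secondEndpointNodes G T)
    (fun r a => ∃ u, r = (a.2.1, s(u, a.2.2)) ∧ IsEdgeQuery G T a u ∧
      (a.2.1, u) ∈ a.1.map Prod.fst) ?_ ?_
  · simpa [Finset.card_product] using this
  · rintro ⟨j, e⟩ hr
    have he : e ∈ G.edgeSet := by simpa [edgeFin] using hr
    obtain ⟨u, v, L, M, rfl, -, hM, -, h⟩ := exists_isEdgeQuery_pair hT he j
    exact ⟨(M, (j, v)), Finset.mem_filter.2 ⟨hM.isFirstQuery.mem_nodes, u, hM, h⟩,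
      u, rfl, hM, h⟩
  · rintro a - r ⟨-, u, rfl, hu, hu'⟩ r' ⟨-, w, rfl, hw, -⟩
    rw [hu.eq_of_mem hw hu']

end IsEdge

/-- if every vertex cover of `G` has size at least `k'`, then any decision
tree computing the partial function `ℓ-IsEdge_G : ℓ-D_G → {0,1}` has size at least
`(ℓ+1)(k'+m)`. -/
theorem stmt9 {n : ℕ} (G : SimpleGraph (Fin n)) (ℓ k' : ℕ) (hℓ : 1 ≤ ℓ)
    (hvc : ∀ K : Finset (Fin n), IsVC G K → k' ≤ K.card)
    (T : DTree (Fin (ℓ + 1) × Fin n))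
    (hT : ∀ z ∈ ellDom G ℓ, T.eval z = ellIsEdge G ℓ z) :
    (ℓ + 1) * (k' + (edgeFin G).card) ≤ T.size := by
  have hsub : (firstEndpointNodes G T ∪ secondEndpointNodes G T).card ≤ T.nodes.card :=
    Finset.card_le_card
      (Finset.union_subset (Finset.filter_subset _ _) (Finset.filter_subset _ _))
  rw [Finset.card_union_of_disjoint disjoint_endpointNodes] at hsub
  have h1 := mul_le_card_firstEndpointNodes hvc hT
  have h2 := mul_le_card_secondEndpointNodes hT
  have h3 := T.card_nodes_lt_size
  rw [mul_add]
  omega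
end
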